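/- arXiv:1805.08300 — 2 statements merged into one kernel-verified Lean document; each statement's English description precedes it below -/
import Mathlib

section
/- Let Π be a nonnegative function on the q×q real symmetric positive definite matrices such that Π(Σ) = π(log λ₁(Σ), …, log λ_q(Σ)), where π : ℝ^q → ℝ is convex and permutation-invariant and λ₁(Σ) ≥ ⋯ ≥ λ_q(Σ) > 0 are the eigenvalues of Σ in decreasing order. Let S be positive definite with spectral decomposition S = P D Pᵀ, P orthogonal, D = diag(d₁, …, d_q), d₁ ≥ ⋯ ≥ d_q > 0. Then for every η ≥ 0 the function L(Σ; S, η) = tr(Σ⁻¹S) + log det(Σ) + η·Π(Σ) has a unique global minimizer over positive definite Σ, and this minimizer equals P Λ̂ Pᵀ, where Λ̂ = diag(λ̂₁, …, λ̂_q) and (λ̂₁, …, λ̂_q) is the unique minimizer of ℒ(λ) = Σ_{j=1}^q (d_j/λ_j + log λ_j) + η·π(log λ₁, …, log λ_q) over the set {λ ∈ ℝ^q : λ₁ ≥ ⋯ ≥ λ_q > 0}. -/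
open Matrix

/-- The eigenvalues of a Hermitian real matrix, sorted in decreasing order. -/
noncomputable def eigsDesc {q : ℕ} (A : Matrix (Fin q) (Fin q) ℝ)
    (hA : A.IsHermitian) : Fin q → ℝ :=
  fun i => (hA.eigenvalues ∘ Tuple.sort hA.eigenvalues) i.rev

lemma aux_birkhoff {q : ℕ} (π : (Fin q → ℝ) → ℝ)
    (hπconv : ConvexOn ℝ Set.univ π)
    (hπperm : ∀ (σ : Equiv.Perm (Fin q)) (y : Fin q → ℝ), π (y ∘ σ) = π y)
    (M : Matrix (Fin q) (Fin q) ℝ) (hM : M ∈ doublyStochastic ℝ (Fin q)) (x : Fin q → ℝ) :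
    π (M *ᵥ x) ≤ π x := by
  obtain ⟨w, hw0, hw1, rfl⟩ := exists_eq_sum_perm_of_mem_doublyStochastic hM
  have h1 : (∑ σ, w σ • σ.permMatrix ℝ) *ᵥ x = ∑ σ, w σ • (x ∘ σ) := by
    rw [Matrix.sum_mulVec]
    refine Finset.sum_congr rfl fun σ _ => ?_
    rw [Matrix.smul_mulVec, Matrix.permMatrix_mulVec]
  rw [h1]
  calc π (∑ σ, w σ • (x ∘ σ)) ≤ ∑ σ, w σ • π (x ∘ σ) :=
        hπconv.map_sum_le (fun σ _ => hw0 σ) hw1 (fun _ _ => Set.mem_univ _)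
    _ = π x := by
        simp_rw [hπperm, smul_eq_mul]
        rw [← Finset.sum_mul, hw1, one_mul]

lemma aux_perm {q : ℕ} (π : (Fin q → ℝ) → ℝ)
    (hπperm : ∀ (σ : Equiv.Perm (Fin q)) (y : Fin q → ℝ), π (y ∘ σ) = π y)
    (f g : Fin q → ℝ) (h : Multiset.map f Finset.univ.val = Multiset.map g Finset.univ.val)
    (l : ℝ → ℝ) : π (l ∘ f) = π (l ∘ g) := by
  have hfg : f ∘ Tuple.sort f = g ∘ Tuple.sort g := by
    apply List.ofFn_injective
    rw [Fin.univ_val_map, Fin.univ_val_map, Multiset.coe_eq_coe] at h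
    have hp : (List.ofFn (f ∘ Tuple.sort f)).Perm (List.ofFn (g ∘ Tuple.sort g)) :=
      ((Equiv.Perm.ofFn_comp_perm _ _).trans h).trans (Equiv.Perm.ofFn_comp_perm _ _).symm
    refine hp.eq_of_pairwise' (r := (· ≤ ·)) ?_ ?_
    · exact ((Tuple.monotone_sort f).sortedLE_ofFn).pairwise
    · exact ((Tuple.monotone_sort g).sortedLE_ofFn).pairwise
  rw [← hπperm (Tuple.sort f) (l ∘ f), ← hπperm (Tuple.sort g) (l ∘ g)]
  rw [Function.comp_assoc, hfg, Function.comp_assoc]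

lemma aux_posdef {q : ℕ} (P : Matrix (Fin q) (Fin q) ℝ) (hP : Pᵀ * P = 1) (m : Fin q → ℝ)
    (hm : ∀ i, 0 < m i) : (P * diagonal m * Pᵀ).PosDef := by
  have hU : IsUnit P := IsUnit.of_mul_eq_one_right _ hP
  have := (Matrix.IsUnit.posDef_star_right_conjugate_iff (x := diagonal m) hU).2
    (Matrix.PosDef.diagonal hm)
  simpa [Matrix.star_eq_conjTranspose] using this

lemma aux_pen {q : ℕ} (π : (Fin q → ℝ) → ℝ)
    (hπperm : ∀ (σ : Equiv.Perm (Fin q)) (y : Fin q → ℝ), π (y ∘ σ) = π y)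
    (A P : Matrix (Fin q) (Fin q) ℝ) (hP : Pᵀ * P = 1) (m : Fin q → ℝ)
    (hA : A.IsHermitian) (h : A = P * diagonal m * Pᵀ) :
    (π fun i => Real.log (eigsDesc A hA i)) = π fun i => Real.log (m i) := by
  have h1 : (π fun i => Real.log (eigsDesc A hA i)) = π (Real.log ∘ hA.eigenvalues) :=
    hπperm (Fin.revPerm.trans (Tuple.sort hA.eigenvalues)) (Real.log ∘ hA.eigenvalues)
  rw [h1]
  refine aux_perm π hπperm _ m ?_ Real.log
  have h2 := hA.roots_charpoly_eq_eigenvalues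
  have h3 : A.charpoly = ∏ i, (Polynomial.X - Polynomial.C (m i)) := by
    rw [h, charpoly_mul_comm, ← mul_assoc, hP, one_mul, charpoly_diagonal]
  rw [h3, Polynomial.roots_prod _ _ (by simp [Finset.prod_ne_zero_iff, Polynomial.X_sub_C_ne_zero])] at h2
  simp at h2
  rw [Fin.univ_val_map, Fin.univ_val_map, Multiset.coe_eq_coe]
  exact h2.symm

/-- The reduced objective in log coordinates. -/
noncomputable def auxF {q : ℕ} (π : (Fin q → ℝ) → ℝ) (d : Fin q → ℝ) (η : ℝ)
    (y : Fin q → ℝ) : ℝ :=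
  (∑ j, (d j * Real.exp (-y j) + y j)) + η * π y

lemma aux_tangent (x y : ℝ) : Real.exp (-y) * (1 - (x - y)) ≤ Real.exp (-x) := by
  have := Real.add_one_le_exp (y - x)
  have h2 : Real.exp (-x) = Real.exp (-y) * Real.exp (y - x) := by
    rw [← Real.exp_add]; ring_nf
  rw [h2]
  have := Real.exp_pos (-y)
  gcongr; linarith

lemma aux_tangent_lt (x y : ℝ) (h : x ≠ y) : Real.exp (-y) * (1 - (x - y)) < Real.exp (-x) := by
  have := Real.add_one_lt_exp (sub_ne_zero.2 h.symm)
  have h2 : Real.exp (-x) = Real.exp (-y) * Real.exp (y - x) := by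
    rw [← Real.exp_add]; ring_nf
  rw [h2]
  have := Real.exp_pos (-y)
  gcongr; linarith

lemma aux_exists {q : ℕ} (π : (Fin q → ℝ) → ℝ) (hπconv : ConvexOn ℝ Set.univ π)
    (hπ0 : ∀ y, 0 ≤ π y) (d : Fin q → ℝ) (hd : ∀ i, 0 < d i) (η : ℝ) (hη : 0 ≤ η) :
    ∃ y, ∀ z, auxF π d η y ≤ auxF π d η z := by
  have hcont : Continuous (auxF π d η) := by
    have : Continuous π := hπconv.locallyLipschitz.continuous
    unfold auxF
    fun_prop
  have hlow : ∀ j (t : ℝ), 1 + Real.log (d j) ≤ d j * Real.exp (-t) + t := by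
    intro j t
    have := Real.add_one_le_exp (Real.log (d j) - t)
    rw [Real.exp_sub, Real.exp_log (hd j), div_eq_mul_inv, ← Real.exp_neg] at this
    linarith
  have hlow2 : ∀ j (t : ℝ), 2 + 2 * Real.log (d j / 2) - t ≤ d j * Real.exp (-t) + t := by
    intro j t
    have := Real.add_one_le_exp (Real.log (d j / 2) - t)
    rw [Real.exp_sub, Real.exp_log (half_pos (hd j)), div_eq_mul_inv _ (Real.exp t), ← Real.exp_neg] at this
    linarith
  set C : Fin q → ℝ := fun j => auxF π d η 0 - ∑ i ∈ Finset.univ.erase j, (1 + Real.log (d i))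
  have hbd : ∀ y, auxF π d η y ≤ auxF π d η 0 → ∀ j, d j * Real.exp (-y j) + y j ≤ C j := by
    intro y hy j
    have h1 : (∑ j, (d j * Real.exp (-y j) + y j)) ≤ auxF π d η y := by
      unfold auxF
      have := mul_nonneg hη (hπ0 y)
      linarith
    rw [← Finset.add_sum_erase _ _ (Finset.mem_univ j)] at h1
    have h2 : ∑ i ∈ Finset.univ.erase j, (1 + Real.log (d i)) ≤
      ∑ i ∈ Finset.univ.erase j, (d i * Real.exp (-y i) + y i) :=
      Finset.sum_le_sum fun i _ => hlow i _
    simp only [C]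
    linarith
  set K : Set (Fin q → ℝ) := Set.Icc (fun j => 2 + 2 * Real.log (d j / 2) - C j) C
  have hmem : ∀ y, auxF π d η y ≤ auxF π d η 0 → y ∈ K := by
    intro y hy
    refine ⟨fun j => ?_, fun j => ?_⟩
    · have := hbd y hy j
      have := hlow2 j (y j)
      show 2 + 2 * Real.log (d j / 2) - C j ≤ y j
      linarith
    · have := hbd y hy j
      have := mul_pos (hd j) (Real.exp_pos (-y j))
      linarith
  obtain ⟨y, hyK, hy⟩ := (isCompact_Icc : IsCompact K).exists_isMinOn ⟨0, hmem 0 le_rfl⟩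
    hcont.continuousOn
  refine ⟨y, fun z => ?_⟩
  rcases le_total (auxF π d η z) (auxF π d η 0) with h | h
  · exact hy (hmem z h)
  · exact (hy (hmem 0 le_rfl)).trans h

lemma aux_unique {q : ℕ} (π : (Fin q → ℝ) → ℝ) (hπconv : ConvexOn ℝ Set.univ π)
    (d : Fin q → ℝ) (hd : ∀ i, 0 < d i) (η : ℝ) (hη : 0 ≤ η) (y : Fin q → ℝ)
    (hy : ∀ z, auxF π d η y ≤ auxF π d η z) (z : Fin q → ℝ)
    (hz : auxF π d η z ≤ auxF π d η y) : z = y := by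
  by_contra hne
  obtain ⟨k, hk⟩ := Function.ne_iff.1 hne
  set m : Fin q → ℝ := (1/2 : ℝ) • y + (1/2 : ℝ) • z with hm
  have hmj : ∀ j, m j = (y j + z j) / 2 := by intro j; simp [hm]; ring
  have h1 : π m ≤ (1/2) * π y + (1/2) * π z := by
    exact hπconv.2 (Set.mem_univ y) (Set.mem_univ z)
      (by norm_num : (0:ℝ) ≤ 1/2) (by norm_num : (0:ℝ) ≤ 1/2) (by norm_num)
  have h2 : ∑ j, (d j * Real.exp (-m j) + m j) <
      ∑ j, ((1/2) * (d j * Real.exp (-y j) + y j) + (1/2) * (d j * Real.exp (-z j) + z j)) := by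
    have key : ∀ j, d j * (Real.exp (-m j) * (1 - (y j - m j)) + Real.exp (-m j) * (1 - (z j - m j)))
        = 2 * (d j * Real.exp (-m j)) := by
      intro j; rw [hmj]; ring
    apply Finset.sum_lt_sum
    · intro j _
      have a := aux_tangent (y j) (m j)
      have b := aux_tangent (z j) (m j)
      have := mul_le_mul_of_nonneg_left (add_le_add a b) (hd j).le
      rw [key] at this
      linarith [hmj j]
    · refine ⟨k, Finset.mem_univ _, ?_⟩
      have a := aux_tangent_lt (y k) (m k) (by rw [hmj]; intro h; apply hk; linarith)
      have b := aux_tangent (z k) (m k)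
      have := mul_lt_mul_of_pos_left (add_lt_add_of_lt_of_le a b) (hd k)
      rw [key] at this
      linarith [hmj k]
  have h5 : ∀ u v : Fin q → ℝ, ∑ j, ((1/2) * u j + (1/2) * v j)
      = (1/2) * ∑ j, u j + (1/2) * ∑ j, v j := by
    intro u v
    rw [Finset.sum_add_distrib, ← Finset.mul_sum, ← Finset.mul_sum]
  rw [h5] at h2
  have h3 := hy m
  have h4 := mul_le_mul_of_nonneg_left h1 hη
  unfold auxF at h3 hz
  linarith

lemma aux_anti {q : ℕ} (π : (Fin q → ℝ) → ℝ) (hπconv : ConvexOn ℝ Set.univ π)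
    (hπperm : ∀ (σ : Equiv.Perm (Fin q)) (y : Fin q → ℝ), π (y ∘ σ) = π y)
    (d : Fin q → ℝ) (hd : ∀ i, 0 < d i) (hdanti : Antitone d) (η : ℝ) (hη : 0 ≤ η)
    (y : Fin q → ℝ) (hy : ∀ z, auxF π d η y ≤ auxF π d η z) : Antitone y := by
  intro i j hij
  by_contra! hlt
  have hne : i ≠ j := by rintro rfl; exact lt_irrefl _ hlt
  have hsw : auxF π d η (y ∘ Equiv.swap i j) ≤ auxF π d η y := by
    unfold auxF
    rw [hπperm]
    have hj : j ∈ Finset.univ.erase i := by simp [hne.symm]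
    rw [← Finset.add_sum_erase _ _ (Finset.mem_univ i), ← Finset.add_sum_erase _ _ hj]
    rw [← Finset.add_sum_erase Finset.univ (fun j => d j * Real.exp (-y j) + y j)
      (Finset.mem_univ i), ← Finset.add_sum_erase _ (fun j => d j * Real.exp (-y j) + y j) hj]
    have hrest : ∑ x ∈ (Finset.univ.erase i).erase j, (d x * Real.exp (-(y ∘ Equiv.swap i j) x)
        + (y ∘ Equiv.swap i j) x)
        = ∑ x ∈ (Finset.univ.erase i).erase j, (d x * Real.exp (-y x) + y x) := by
      refine Finset.sum_congr rfl fun x hx => ?_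
      simp only [Finset.mem_erase] at hx
      simp [Equiv.swap_apply_of_ne_of_ne hx.2.1 hx.1]
    rw [hrest]
    simp only [Function.comp, Equiv.swap_apply_left, Equiv.swap_apply_right]
    have he : Real.exp (-y j) < Real.exp (-y i) := Real.exp_lt_exp.2 (by linarith)
    nlinarith [hdanti hij]
  have := congrFun (aux_unique π hπconv d hd η hη y hy _ hsw) i
  simp at this
  linarith

lemma aux_orth {q : ℕ} (R : Matrix (Fin q) (Fin q) ℝ) (h : Rᵀ * R = 1) (j : Fin q) :
    ∑ i, R i j ^ 2 = 1 := by
  have := congrFun (congrFun h j) j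
  simpa [Matrix.mul_apply, sq] using this

lemma aux_inv {q : ℕ} (P : Matrix (Fin q) (Fin q) ℝ) (hP : Pᵀ * P = 1) (m : Fin q → ℝ)
    (hm : ∀ i, 0 < m i) :
    (P * diagonal m * Pᵀ)⁻¹ = P * diagonal (fun i => (m i)⁻¹) * Pᵀ := by
  have hP' : P * Pᵀ = 1 := mul_eq_one_comm.1 hP
  apply Matrix.inv_eq_right_inv
  calc P * diagonal m * Pᵀ * (P * diagonal (fun i => (m i)⁻¹) * Pᵀ)
      = P * (diagonal m * (Pᵀ * P) * diagonal (fun i => (m i)⁻¹)) * Pᵀ := by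
        simp only [Matrix.mul_assoc]
    _ = 1 := by
        rw [hP, Matrix.mul_one, diagonal_mul_diagonal]
        have : (fun i => m i * (m i)⁻¹) = fun _ => (1:ℝ) := by
          funext i; exact mul_inv_cancel₀ (hm i).ne'
        rw [this, diagonal_one, Matrix.mul_one, hP']

lemma aux_logdet {q : ℕ} (P : Matrix (Fin q) (Fin q) ℝ) (hP : Pᵀ * P = 1) (m : Fin q → ℝ)
    (hm : ∀ i, 0 < m i) :
    Real.log (P * diagonal m * Pᵀ).det = ∑ i, Real.log (m i) := by
  rw [det_mul_comm, ← Matrix.mul_assoc, hP, Matrix.one_mul, det_diagonal,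
    Real.log_prod (fun i _ => (hm i).ne')]

lemma aux_trace {q : ℕ} (Q P : Matrix (Fin q) (Fin q) ℝ) (a d : Fin q → ℝ) :
    (Q * diagonal a * Qᵀ * (P * diagonal d * Pᵀ)).trace
      = ∑ j, d j * ∑ i, (Qᵀ * P) i j ^ 2 * a i := by
  have h : (Q * diagonal a * Qᵀ * (P * diagonal d * Pᵀ)).trace
      = ((Qᵀ * P)ᵀ * (diagonal a * (Qᵀ * P) * diagonal d)).trace := by
    rw [Matrix.trace_mul_comm]
    rw [show P * diagonal d * Pᵀ * (Q * diagonal a * Qᵀ)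
      = P * (diagonal d * (Pᵀ * (Q * (diagonal a * Qᵀ)))) by simp only [Matrix.mul_assoc]]
    rw [Matrix.trace_mul_comm, Matrix.mul_assoc, Matrix.trace_mul_comm, transpose_mul,
      transpose_transpose]
    simp only [Matrix.mul_assoc]
  rw [h, Matrix.trace]
  refine Finset.sum_congr rfl fun j _ => ?_
  rw [Matrix.diag_apply, Matrix.mul_apply, Finset.mul_sum]
  refine Finset.sum_congr rfl fun i _ => ?_
  rw [Matrix.mul_diagonal, Matrix.diagonal_mul, transpose_apply]
  ring

/-- Value of the objective at a matrix diagonalised by `P`. -/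
lemma aux_diag {q : ℕ} (P : Matrix (Fin q) (Fin q) ℝ) (hP : Pᵀ * P = 1) (m d : Fin q → ℝ)
    (hm : ∀ i, 0 < m i) :
    ((P * diagonal m * Pᵀ)⁻¹ * (P * diagonal d * Pᵀ)).trace = ∑ j, d j * (m j)⁻¹ := by
  rw [aux_inv P hP m hm, aux_trace, hP]
  refine Finset.sum_congr rfl fun j _ => ?_
  congr 1
  rw [Finset.sum_eq_single j]
  · simp
  · intro i _ hij; simp [Matrix.one_apply_ne hij]
  · simp

lemma aux_lower {q : ℕ} (π : (Fin q → ℝ) → ℝ) (hπconv : ConvexOn ℝ Set.univ π)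
    (hπperm : ∀ (σ : Equiv.Perm (Fin q)) (y : Fin q → ℝ), π (y ∘ σ) = π y)
    (d : Fin q → ℝ) (hd : ∀ i, 0 < d i) (η : ℝ) (hη : 0 ≤ η)
    (R : Matrix (Fin q) (Fin q) ℝ) (hR : Rᵀ * R = 1) (x : Fin q → ℝ) :
    ∃ y : Fin q → ℝ, auxF π d η y ≤
        (∑ j, d j * ∑ i, R i j ^ 2 * Real.exp (-x i)) + ∑ i, x i + η * π x ∧
      ((∑ j, d j * ∑ i, R i j ^ 2 * Real.exp (-x i)) + ∑ i, x i + η * π x ≤ auxF π d η y →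
        ∀ i j, R i j ≠ 0 → x i = y j) := by
  have hcol : ∀ j, ∑ i, R i j ^ 2 = 1 := aux_orth R hR
  have hrow : ∀ i, ∑ j, R i j ^ 2 = 1 :=
    fun i => aux_orth Rᵀ (by rw [transpose_transpose]; exact mul_eq_one_comm.1 hR) i
  let M : Matrix (Fin q) (Fin q) ℝ := Matrix.of fun j i => R i j ^ 2
  have hM : M ∈ doublyStochastic ℝ (Fin q) :=
    mem_doublyStochastic_iff_sum.2 ⟨fun j i => sq_nonneg (R i j), hcol, hrow⟩
  have hyj : ∀ j, (M *ᵥ x) j = ∑ i, R i j ^ 2 * x i := fun j => rfl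
  have hπle := aux_birkhoff π hπconv hπperm M hM x
  set y := M *ᵥ x
  have hsum : ∑ j, y j = ∑ i, x i := by
    simp_rw [hyj]
    rw [Finset.sum_comm]
    simp_rw [← Finset.sum_mul, hrow, one_mul]
  have hlin : ∀ j, ∑ i, R i j ^ 2 * (Real.exp (-y j) * (1 - (x i - y j))) = Real.exp (-y j) := by
    intro j
    have : ∀ i, R i j ^ 2 * (Real.exp (-y j) * (1 - (x i - y j)))
        = Real.exp (-y j) * ((1 + y j) * R i j ^ 2 - R i j ^ 2 * x i) := fun i => by ring
    simp_rw [this]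
    rw [← Finset.mul_sum, Finset.sum_sub_distrib, ← Finset.mul_sum, hcol, ← hyj]
    ring
  have hj : ∀ j, d j * Real.exp (-y j) ≤ d j * ∑ i, R i j ^ 2 * Real.exp (-x i) := by
    intro j
    refine mul_le_mul_of_nonneg_left ?_ (hd j).le
    rw [← hlin j]
    exact Finset.sum_le_sum fun i _ =>
      mul_le_mul_of_nonneg_left (aux_tangent (x i) (y j)) (sq_nonneg _)
  have hpi := mul_le_mul_of_nonneg_left hπle hη
  refine ⟨y, ?_, ?_⟩
  · unfold auxF
    rw [Finset.sum_add_distrib, hsum]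
    have := Finset.sum_le_sum fun j (_ : j ∈ Finset.univ) => hj j
    linarith
  · intro hle i j hij
    by_contra hne
    have hs : d j * Real.exp (-y j) < d j * ∑ i, R i j ^ 2 * Real.exp (-x i) := by
      refine mul_lt_mul_of_pos_left ?_ (hd j)
      conv_lhs => rw [← hlin j]
      refine Finset.sum_lt_sum (fun i _ =>
        mul_le_mul_of_nonneg_left (aux_tangent (x i) (y j)) (sq_nonneg _)) ⟨i, Finset.mem_univ _, ?_⟩
      exact mul_lt_mul_of_pos_left (aux_tangent_lt _ _ hne) (by positivity)
    have := Finset.sum_lt_sum (fun j (_ : j ∈ Finset.univ) => hj j) ⟨j, Finset.mem_univ _, hs⟩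
    unfold auxF at hle
    rw [Finset.sum_add_distrib, hsum] at hle
    linarith

/-- for a nonnegative orthogonally invariant penalty
`Π(Σ) = π(log λ₁(Σ), …, log λ_q(Σ))` with `π` convex and permutation-invariant,
and `S = P D Pᵀ` positive definite with decreasing eigenvalues `d`, the penalized
objective `L(Σ; S, η)` has a unique global minimizer over positive definite `Σ`,
namely `P Λ̂ Pᵀ` where `Λ̂ = diag(λ̂)` and `λ̂` is the unique minimizer of
`ℒ(λ) = ∑_j (d_j/λ_j + log λ_j) + η π(log λ)` over `λ₁ ≥ ⋯ ≥ λ_q > 0`. -/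
theorem stmt_6 (q : ℕ) (π : (Fin q → ℝ) → ℝ)
    (hπconv : ConvexOn ℝ Set.univ π)
    (hπperm : ∀ (σ : Equiv.Perm (Fin q)) (y : Fin q → ℝ), π (y ∘ σ) = π y)
    (Pen : Matrix (Fin q) (Fin q) ℝ → ℝ)
    (hPennn : ∀ A : Matrix (Fin q) (Fin q) ℝ, A.PosDef → 0 ≤ Pen A)
    (hPen : ∀ (A : Matrix (Fin q) (Fin q) ℝ) (hA : A.PosDef),
      Pen A = π fun i => Real.log (eigsDesc A hA.isHermitian i))
    (S P : Matrix (Fin q) (Fin q) ℝ) (d : Fin q → ℝ)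
    (hP : Pᵀ * P = 1) (hdanti : Antitone d) (hdpos : ∀ i, 0 < d i)
    (hSdec : S = P * diagonal d * Pᵀ)
    (η : ℝ) (hη : 0 ≤ η)
    (L : Matrix (Fin q) (Fin q) ℝ → ℝ)
    (hL : ∀ B : Matrix (Fin q) (Fin q) ℝ,
      L B = (B⁻¹ * S).trace + Real.log B.det + η * Pen B)
    (calL : (Fin q → ℝ) → ℝ)
    (hcalL : ∀ lam : Fin q → ℝ,
      calL lam = (∑ j, (d j / lam j + Real.log (lam j))) +
        η * π fun j => Real.log (lam j)) :
    ∃ lamhat : Fin q → ℝ,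
      (Antitone lamhat ∧ ∀ i, 0 < lamhat i) ∧
      (∀ lam : Fin q → ℝ, Antitone lam → (∀ i, 0 < lam i) →
        calL lamhat ≤ calL lam ∧ (calL lam = calL lamhat → lam = lamhat)) ∧
      (P * diagonal lamhat * Pᵀ).PosDef ∧
      (∀ A : Matrix (Fin q) (Fin q) ℝ, A.PosDef →
        L (P * diagonal lamhat * Pᵀ) ≤ L A ∧
        (L A = L (P * diagonal lamhat * Pᵀ) → A = P * diagonal lamhat * Pᵀ)) := by
  subst hSdec
  have hP' : P * Pᵀ = 1 := mul_eq_one_comm.1 hP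
  -- nonnegativity of `π`
  have hπ0 : ∀ y, 0 ≤ π y := by
    intro y
    have h1 : (1 : Matrix (Fin q) (Fin q) ℝ)ᵀ * 1 = 1 := by simp
    have hpd := aux_posdef 1 h1 (fun i => Real.exp (y i)) (fun i => Real.exp_pos _)
    have h2 := hPennn _ hpd
    rw [hPen _ hpd, aux_pen π hπperm _ 1 h1 _ hpd.isHermitian rfl] at h2
    simpa using h2
  obtain ⟨y, hy⟩ := aux_exists π hπconv hπ0 d hdpos η hη
  have huniq := aux_unique π hπconv d hdpos η hη y hy
  have hanti := aux_anti π hπconv hπperm d hdpos hdanti η hη y hy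
  have hcalF : ∀ lam : Fin q → ℝ, (∀ i, 0 < lam i) →
      calL lam = auxF π d η (fun i => Real.log (lam i)) := by
    intro lam hlam
    rw [hcalL, auxF]
    congr 1
    refine Finset.sum_congr rfl fun j _ => ?_
    rw [Real.exp_neg, Real.exp_log (hlam j), div_eq_mul_inv]
  have hpos : ∀ i, 0 < Real.exp (y i) := fun i => Real.exp_pos _
  have hcy : calL (fun i => Real.exp (y i)) = auxF π d η y := by
    rw [hcalF _ hpos]; simp
  have hpd := aux_posdef P hP _ hpos
  have hLy : L (P * diagonal (fun i => Real.exp (y i)) * Pᵀ) = auxF π d η y := by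
    rw [hL, hPen _ hpd, aux_pen π hπperm _ P hP _ hpd.isHermitian rfl, aux_diag P hP _ d hpos,
      aux_logdet P hP _ hpos, auxF, Finset.sum_add_distrib]
    simp [Real.exp_neg]
  refine ⟨fun i => Real.exp (y i), ⟨fun i j hij => Real.exp_le_exp.2 (hanti hij), hpos⟩,
    ?_, hpd, ?_⟩
  · intro lam _ hlam
    rw [hcy, hcalF lam hlam]
    refine ⟨hy _, fun h => ?_⟩
    have := huniq _ h.le
    funext i
    rw [← this, Real.exp_log (hlam i)]
  · intro A hA
    rw [hLy]
    obtain ⟨Q, hQ, m, hm, hAQ⟩ : ∃ Q : Matrix (Fin q) (Fin q) ℝ, Qᵀ * Q = 1 ∧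
        ∃ m : Fin q → ℝ, (∀ i, 0 < m i) ∧ A = Q * diagonal m * Qᵀ := by
      refine ⟨hA.isHermitian.eigenvectorUnitary, ?_, hA.isHermitian.eigenvalues,
        hA.eigenvalues_pos, ?_⟩
      · have := Unitary.coe_star_mul_self hA.isHermitian.eigenvectorUnitary
        simpa [Matrix.star_eq_conjTranspose] using this
      · have := hA.isHermitian.spectral_theorem
        rw [Unitary.conjStarAlgAut_apply] at this
        simpa [Matrix.star_eq_conjTranspose, Function.comp_def] using this
    have hQ' : Q * Qᵀ = 1 := mul_eq_one_comm.1 hQ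
    have hR : (Qᵀ * P)ᵀ * (Qᵀ * P) = 1 := by
      rw [transpose_mul, transpose_transpose, Matrix.mul_assoc, ← Matrix.mul_assoc Q, hQ',
        Matrix.one_mul, hP]
    have hLA : L A = (∑ j, d j * ∑ i, (Qᵀ * P) i j ^ 2 * Real.exp (-Real.log (m i)))
        + ∑ i, Real.log (m i) + η * π (fun i => Real.log (m i)) := by
      rw [hL, hPen A hA, aux_pen π hπperm A Q hQ m hA.isHermitian hAQ, hAQ, aux_inv Q hQ m hm,
        aux_trace, aux_logdet Q hQ m hm]
      simp only [Real.exp_neg, Real.exp_log (hm _)]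
    obtain ⟨z, hz1, hz2⟩ := aux_lower π hπconv hπperm d hdpos η hη _ hR (fun i => Real.log (m i))
    rw [hLA]
    refine ⟨(hy z).trans hz1, fun h => ?_⟩
    have hzy : z = y := huniq z (hz1.trans h.le)
    have hx := hz2 (h.le.trans (hy z))
    have hcomm : diagonal m * (Qᵀ * P) = (Qᵀ * P) * diagonal (fun i => Real.exp (y i)) := by
      ext i j
      rw [diagonal_mul, mul_diagonal]
      by_cases h0 : (Qᵀ * P) i j = 0
      · rw [h0]; simp
      · rw [← hzy, ← hx i j h0, Real.exp_log (hm i), mul_comm]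
    calc A = Q * (diagonal m * (Qᵀ * P)) * Pᵀ := by
          rw [hAQ]
          simp only [Matrix.mul_assoc, hP', Matrix.mul_one]
      _ = (Q * Qᵀ) * P * diagonal (fun i => Real.exp (y i)) * Pᵀ := by
          rw [hcomm]; simp only [Matrix.mul_assoc]
      _ = _ := by rw [hQ', Matrix.one_mul]
end

section
/- Let Π be a nonnegative function on the q×q real symmetric positive definite matrices such that Π(Σ) = π(log λ₁(Σ), …, log λ_q(Σ)) for a convex, permutation-invariant π : ℝ^q → ℝ, where λ₁(Σ) ≥ ⋯ ≥ λ_q(Σ) are the eigenvalues of Σ in decreasing order. Let S be positive definite, and for η ≥ 0 let Σ̂_η denote the unique global minimizer over positive definite Σ of L(Σ; S, η) = tr(Σ⁻¹S) + log det(Σ) + η·Π(Σ). Then the map η ↦ Σ̂_η is continuous on [0, ∞). -/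
open Matrix

open Matrix Filter Topology

noncomputable def Mfun {q : ℕ} (U : Matrix (Fin q) (Fin q) ℝ) (y : Fin q → ℝ) :
    Matrix (Fin q) (Fin q) ℝ := U * diagonal (fun i => Real.exp (y i)) * Uᵀ

def Oset (q : ℕ) : Set (Matrix (Fin q) (Fin q) ℝ) := {U | Uᵀ * U = 1}

lemma Oset_compact (q : ℕ) : IsCompact (Oset q) := by
  have h1 : IsCompact (Set.pi Set.univ (fun _ : Fin q => Set.pi Set.univ
      (fun _ : Fin q => Set.Icc (-1:ℝ) 1))) :=
    isCompact_univ_pi fun _ => isCompact_univ_pi fun _ => isCompact_Icc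
  have hc : IsClosed (Oset q) := isClosed_eq (by fun_prop) (by fun_prop)
  refine IsCompact.of_isClosed_subset (X := Matrix (Fin q) (Fin q) ℝ) h1 hc ?_
  intro U hU i _ j _
  have h := congrFun (congrFun hU j) j
  rw [mul_apply, one_apply_eq] at h
  have h2 : U i j * U i j ≤ ∑ k, Uᵀ j k * U k j :=
    Finset.single_le_sum (f := fun k => Uᵀ j k * U k j)
      (fun k _ => mul_self_nonneg _) (Finset.mem_univ i)
  rw [h] at h2
  exact abs_le.mp (abs_le_one_iff_mul_self_le_one.mpr h2)

lemma Oset_right {q : ℕ} {U : Matrix (Fin q) (Fin q) ℝ} (hU : U ∈ Oset q) : U * Uᵀ = 1 :=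
  mul_eq_one_comm.mp hU

lemma Mfun_inv {q : ℕ} {U : Matrix (Fin q) (Fin q) ℝ} (hU : U ∈ Oset q) (y : Fin q → ℝ) :
    (Mfun U y)⁻¹ = Mfun U (-y) := by
  apply inv_eq_right_inv
  have h : diagonal (fun i => Real.exp (y i)) * diagonal (fun i => Real.exp ((-y) i)) =
    (1 : Matrix (Fin q) (Fin q) ℝ) := by
    rw [diagonal_mul_diagonal]
    simp [← Real.exp_add]
  unfold Mfun
  calc _ = U * diagonal (fun i => Real.exp (y i)) * (Uᵀ * U) *
        diagonal (fun i => Real.exp ((-y) i)) * Uᵀ := by simp only [Matrix.mul_assoc]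
    _ = U * (diagonal (fun i => Real.exp (y i)) * diagonal (fun i => Real.exp ((-y) i))) * Uᵀ := by
        rw [show Uᵀ * U = 1 from hU]; simp only [Matrix.mul_assoc, Matrix.mul_one]
    _ = 1 := by rw [h, Matrix.mul_one, Oset_right hU]

lemma Oset_isUnit {q : ℕ} {U : Matrix (Fin q) (Fin q) ℝ} (hU : U ∈ Oset q) : IsUnit U :=
  IsUnit.of_mul_eq_one _ (Oset_right hU)

lemma Mfun_posDef {q : ℕ} {U : Matrix (Fin q) (Fin q) ℝ} (hU : U ∈ Oset q) (y : Fin q → ℝ) :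
    (Mfun U y).PosDef := by
  have h : (diagonal (fun i => Real.exp (y i))).PosDef :=
    PosDef.diagonal fun i => Real.exp_pos _
  have := (Matrix.IsUnit.posDef_star_right_conjugate_iff (Oset_isUnit hU)).mpr h
  simpa [Mfun, star_eq_conjTranspose] using this

lemma diag_pos' {q : ℕ} {U S : Matrix (Fin q) (Fin q) ℝ} (hU : U ∈ Oset q) (hS : S.PosDef)
    (i : Fin q) : 0 < (Uᵀ * S * U) i i := by
  have := (Matrix.IsUnit.posDef_star_left_conjugate_iff (Oset_isUnit hU)).mpr hS
  simpa [star_eq_conjTranspose] using this.diag_pos (i := i)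

lemma Mfun_det {q : ℕ} {U : Matrix (Fin q) (Fin q) ℝ} (hU : U ∈ Oset q) (y : Fin q → ℝ) :
    Real.log (Mfun U y).det = ∑ i, y i := by
  unfold Mfun
  rw [det_mul, det_mul, mul_right_comm, ← det_mul, Oset_right hU, det_one, one_mul, det_diagonal,
    ← Real.exp_sum, Real.log_exp]

lemma Mfun_trace {q : ℕ} (U S : Matrix (Fin q) (Fin q) ℝ)  (y : Fin q → ℝ) :
    (Mfun U y * S).trace = ∑ i, Real.exp (y i) * (Uᵀ * S * U) i i := by
  unfold Mfun
  rw [Matrix.mul_assoc, Matrix.mul_assoc, trace_mul_comm, Matrix.mul_assoc, trace]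
  simp [diagonal_mul, Matrix.mul_assoc]

lemma Mfun_surj {q : ℕ} {A : Matrix (Fin q) (Fin q) ℝ} (hA : A.PosDef) :
    ∃ p : Matrix (Fin q) (Fin q) ℝ × (Fin q → ℝ), p.1 ∈ Oset q ∧ A = Mfun p.1 p.2 := by
  refine ⟨(hA.isHermitian.eigenvectorUnitary, fun i => Real.log (hA.isHermitian.eigenvalues i)),
    ?_, ?_⟩
  · exact (Matrix.mem_unitaryGroup_iff'.mp hA.isHermitian.eigenvectorUnitary.2)
  · conv_lhs => rw [hA.isHermitian.spectral_theorem]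
    simp only [Mfun, Real.exp_log (hA.eigenvalues_pos _)]
    rfl

lemma exists_perm_of_map_eq {q : ℕ} (f g : Fin q → ℝ)
    (h : Multiset.map f Finset.univ.val = Multiset.map g Finset.univ.val) :
    ∃ σ : Equiv.Perm (Fin q), f = g ∘ σ := by
  have hp : List.Perm (List.ofFn f) (List.ofFn g) := by
    rw [← Multiset.coe_eq_coe]
    simpa [Fin.univ_val_map] using h
  have e : f ∘ Tuple.sort f = g ∘ Tuple.sort g := by
    apply List.ofFn_injective
    refine List.Perm.eq_of_sortedLE ?_ ?_ ?_
    · exact (Tuple.monotone_sort f).sortedLE_ofFn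
    · exact (Tuple.monotone_sort g).sortedLE_ofFn
    · exact ((Equiv.Perm.ofFn_comp_perm _ f).trans hp).trans (Equiv.Perm.ofFn_comp_perm _ g).symm
  refine ⟨(Tuple.sort f).symm.trans (Tuple.sort g), ?_⟩
  ext i
  have := congrFun e ((Tuple.sort f).symm i)
  simpa using this

lemma Mfun_eigs {q : ℕ} {U : Matrix (Fin q) (Fin q) ℝ} (hU : U ∈ Oset q) (y : Fin q → ℝ)
    (hA : (Mfun U y).IsHermitian) :
    ∃ σ : Equiv.Perm (Fin q), hA.eigenvalues = (fun i => Real.exp (y i)) ∘ σ := by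
  apply exists_perm_of_map_eq
  have h1 := hA.roots_charpoly_eq_eigenvalues
  have h2 : (Mfun U y).charpoly = (diagonal (fun i => Real.exp (y i))).charpoly := by
    unfold Mfun
    rw [charpoly_mul_comm, ← Matrix.mul_assoc, show Uᵀ * U = 1 from hU, Matrix.one_mul]
  rw [h2, charpoly_diagonal, Polynomial.roots_prod _ _
    (by simp [Finset.prod_ne_zero_iff, Polynomial.X_sub_C_ne_zero])] at h1
  simpa [Function.comp_def] using h1.symm

lemma Mfun_pen {q : ℕ} (π : (Fin q → ℝ) → ℝ)
    (hπperm : ∀ (σ : Equiv.Perm (Fin q)) (y : Fin q → ℝ), π (y ∘ σ) = π y)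
    {U : Matrix (Fin q) (Fin q) ℝ} (hU : U ∈ Oset q) (y : Fin q → ℝ)
    (hA : (Mfun U y).IsHermitian) :
    (π fun i => Real.log (eigsDesc (Mfun U y) hA i)) = π y := by
  obtain ⟨σ, hσ⟩ := Mfun_eigs hU y hA
  rw [← hπperm ((Fin.revPerm.trans (Tuple.sort hA.eigenvalues)).trans σ) y]
  congr 1
  ext i
  unfold eigsDesc
  generalize Tuple.sort hA.eigenvalues = τ
  simp [hσ]

lemma scalar_bound (c C y : ℝ) (hc : 0 < c) (h : c * Real.exp (-y) + y ≤ C) :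
    y ∈ Set.Icc (1 - (C - 1 - Real.log (c/2)) / (c/2)) C := by
  have hc2 : 0 < c / 2 := by positivity
  have h1 := Real.add_one_le_exp (Real.log (c/2) - y)
  rw [sub_eq_add_neg, Real.exp_add, Real.exp_log hc2] at h1
  have h2 := Real.add_one_le_exp (-y)
  have h3 : Real.exp (-y) ≤ (C - 1 - Real.log (c/2)) / (c/2) := by
    rw [le_div_iff₀ hc2]; linarith
  have := Real.exp_pos (-y)
  constructor
  · linarith
  · nlinarith

lemma scalar_lower (c y : ℝ) (hc : 0 < c) : 1 + Real.log c ≤ c * Real.exp (-y) + y := by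
  have h1 := Real.add_one_le_exp (Real.log c - y)
  rw [sub_eq_add_neg, Real.exp_add, Real.exp_log hc] at h1
  linarith

lemma exists_c {q : ℕ} {S : Matrix (Fin q) (Fin q) ℝ} (hS : S.PosDef) (i : Fin q) :
    ∃ c : ℝ, 0 < c ∧ ∀ U ∈ Oset q, c ≤ (Uᵀ * S * U) i i := by
  have hne : (Oset q).Nonempty := ⟨1, by simp [Oset]⟩
  have hcont : Continuous (fun U : Matrix (Fin q) (Fin q) ℝ => (Uᵀ * S * U) i i) :=
    Continuous.matrix_elem (by fun_prop) i i
  obtain ⟨U, hU, hm⟩ := (Oset_compact q).exists_isMinOn hne hcont.continuousOn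
  exact ⟨_, diag_pos' hU hS i, fun V hV => hm hV⟩

/-- Sublevel sets are compact in the parametrisation. -/
lemma sublevel {q : ℕ} {S : Matrix (Fin q) (Fin q) ℝ} (hS : S.PosDef) (C : ℝ) :
    ∃ K : Set (Matrix (Fin q) (Fin q) ℝ × (Fin q → ℝ)), IsCompact K ∧ (∀ p ∈ K, p.1 ∈ Oset q) ∧
      ∀ U ∈ Oset q, ∀ y : Fin q → ℝ,
        ((Mfun U y)⁻¹ * S).trace + Real.log (Mfun U y).det ≤ C → (U, y) ∈ K := by
  choose c hc hcU using exists_c (q := q) hS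
  let C' : Fin q → ℝ := fun i => C - ∑ j ∈ Finset.univ.erase i, (1 + Real.log (c j))
  refine ⟨Oset q ×ˢ Set.pi Set.univ
    (fun i => Set.Icc (1 - (C' i - 1 - Real.log (c i/2)) / (c i/2)) (C' i)), 
    (Oset_compact q).prod (isCompact_univ_pi fun _ => isCompact_Icc), fun p hp => hp.1, ?_⟩
  intro U hU y h
  refine ⟨hU, fun i _ => scalar_bound _ _ _ (hc i) ?_⟩
  rw [Mfun_inv hU, Mfun_det hU, Mfun_trace, ← Finset.sum_add_distrib] at h
  have h1 : ∑ j, (c j * Real.exp (-y j) + y j) ≤ C := by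
    refine le_trans (Finset.sum_le_sum fun j _ => ?_) h
    have := mul_le_mul_of_nonneg_left (hcU j U hU) (Real.exp_pos (-y j)).le
    simp only [Pi.neg_apply]
    linarith
  rw [← Finset.add_sum_erase _ _ (Finset.mem_univ i)] at h1
  have h2 := Finset.sum_le_sum (s := Finset.univ.erase i)
    (fun j _ => scalar_lower (c j) (y j) (hc j))
  simp only [C']
  linarith

/-- for a nonnegative penalty `Π(Σ) = π(log λ(Σ))` with `π` convex and
permutation-invariant, and `S` positive definite, the map `η ↦ Σ̂_η` taking `η ≥ 0`
to the unique global minimizer of `L(Σ; S, η) = tr(Σ⁻¹S) + log det Σ + η Π(Σ)`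
over positive definite `Σ` is continuous on `[0, ∞)`. -/
theorem stmt_7 (q : ℕ) (π : (Fin q → ℝ) → ℝ)
    (hπconv : ConvexOn ℝ Set.univ π)
    (hπperm : ∀ (σ : Equiv.Perm (Fin q)) (y : Fin q → ℝ), π (y ∘ σ) = π y)
    (Pen : Matrix (Fin q) (Fin q) ℝ → ℝ)
    (hPennn : ∀ A : Matrix (Fin q) (Fin q) ℝ, A.PosDef → 0 ≤ Pen A)
    (hPen : ∀ (A : Matrix (Fin q) (Fin q) ℝ) (hA : A.PosDef),
      Pen A = π fun i => Real.log (eigsDesc A hA.isHermitian i))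
    (S : Matrix (Fin q) (Fin q) ℝ) (hS : S.PosDef)
    (Sighat : ℝ → Matrix (Fin q) (Fin q) ℝ)
    (hmin : ∀ η : ℝ, 0 ≤ η → (Sighat η).PosDef ∧
      ∀ A : Matrix (Fin q) (Fin q) ℝ, A.PosDef →
        (((Sighat η)⁻¹ * S).trace + Real.log (Sighat η).det + η * Pen (Sighat η) ≤
          (A⁻¹ * S).trace + Real.log A.det + η * Pen A) ∧
        ((A⁻¹ * S).trace + Real.log A.det + η * Pen A =
          ((Sighat η)⁻¹ * S).trace + Real.log (Sighat η).det + η * Pen (Sighat η) →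
          A = Sighat η)) :
    ContinuousOn Sighat (Set.Ici 0) := by
  have hπc : Continuous π := by
    rw [← continuousOn_univ]
    exact hπconv.continuousOn isOpen_univ
  have hP : ∀ U ∈ Oset q, ∀ y, Pen (Mfun U y) = π y := fun U hU y => by
    rw [hPen _ (Mfun_posDef hU y), Mfun_pen π hπperm hU]
  have hex : ∀ η : ℝ, ∃ p : Matrix (Fin q) (Fin q) ℝ × (Fin q → ℝ), 0 ≤ η →
      p.1 ∈ Oset q ∧ Sighat η = Mfun p.1 p.2 := fun η => by
    by_cases h : 0 ≤ η
    · obtain ⟨p, hp⟩ := Mfun_surj (hmin η h).1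
      exact ⟨p, fun _ => hp⟩
    · exact ⟨(1, 0), fun h' => absurd h' h⟩
  choose p hp using hex
  intro η₀ hη₀
  have hη₀' : 0 ≤ η₀ := hη₀
  obtain ⟨K, hK, hKO, hKs⟩ := sublevel hS
    ((S⁻¹ * S).trace + Real.log S.det + (η₀ + 1) * Pen S)
  have hev : ∀ᶠ η in 𝓝[Set.Ici 0] η₀, 0 ≤ η ∧ p η ∈ K := by
    have hlt : ∀ᶠ η in 𝓝[Set.Ici 0] η₀, η < η₀ + 1 :=
      mem_nhdsWithin_of_mem_nhds (Iio_mem_nhds (by linarith))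
    filter_upwards [self_mem_nhdsWithin, hlt] with η h0 h1
    have h0 : 0 ≤ η := h0
    refine ⟨h0, hKs _ (hp η h0).1 _ ?_⟩
    rw [← (hp η h0).2]
    have a1 := ((hmin η h0).2 S hS).1
    have a2 := mul_nonneg h0 (hPennn _ (hmin η h0).1)
    have a3 := mul_le_mul_of_nonneg_right h1.le (hPennn S hS)
    linarith
  unfold ContinuousWithinAt
  rw [tendsto_iff_ultrafilter]
  intro g hg
  have hevg := hg hev
  obtain ⟨p', hp'K, hp'⟩ := isCompact_iff_ultrafilter_le_nhds.mp hK (g.map p) (by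
    rw [le_principal_iff]
    have hm : p ⁻¹' K ∈ (g : Filter ℝ) := mem_of_superset hevg fun η h => h.2
    exact hm)
  have hpt : Tendsto p g (𝓝 p') := hp'
  have hηt : Tendsto (fun η : ℝ => η) g (𝓝 η₀) := (hg.trans nhdsWithin_le_nhds)
  have hMc : Continuous (fun r : Matrix (Fin q) (Fin q) ℝ × (Fin q → ℝ) => Mfun r.1 r.2) := by
    unfold Mfun
    fun_prop
  have hMc' : Continuous (fun r : Matrix (Fin q) (Fin q) ℝ × (Fin q → ℝ) => Mfun r.1 (-r.2)) := by
    unfold Mfun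
    fun_prop
  have hO := hKO _ hp'K
  have hLc : Continuous (fun r : (Matrix (Fin q) (Fin q) ℝ × (Fin q → ℝ)) × ℝ =>
      (Mfun r.1.1 (-r.1.2) * S).trace + ∑ i, r.1.2 i + r.2 * π r.1.2) := by
    refine Continuous.add (Continuous.add ?_ (by fun_prop)) (by fun_prop)
    exact ((hMc'.comp continuous_fst).matrix_mul continuous_const).matrix_trace
  have hst : Tendsto Sighat g (𝓝 (Mfun p'.1 p'.2)) := by
    refine ((hMc.tendsto p').comp hpt).congr' ?_
    filter_upwards [hevg] with η h
    exact ((hp η h.1).2).symm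
  have hLt := (hLc.tendsto (p', η₀)).comp (hpt.prodMk_nhds hηt)
  have hle : ∀ A : Matrix (Fin q) (Fin q) ℝ, A.PosDef →
      ((Mfun p'.1 p'.2)⁻¹ * S).trace + Real.log (Mfun p'.1 p'.2).det
        + η₀ * Pen (Mfun p'.1 p'.2) ≤ (A⁻¹ * S).trace + Real.log A.det + η₀ * Pen A := by
    intro A hA
    rw [Mfun_inv hO, Mfun_det hO, hP _ hO]
    refine le_of_tendsto_of_tendsto hLt
      (((hηt.mul_const (Pen A)).const_add ((A⁻¹ * S).trace + Real.log A.det))) ?_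
    filter_upwards [hevg] with η h
    have h1 := ((hmin η h.1).2 A hA).1
    have h2 := (hp η h.1).1
    rw [(hp η h.1).2, Mfun_inv h2, Mfun_det h2, hP _ h2] at h1
    exact h1
  have hPD := Mfun_posDef hO p'.2
  have hfin := ((hmin η₀ hη₀').2 _ hPD).2
    (le_antisymm (hle _ (hmin η₀ hη₀').1) ((hmin η₀ hη₀').2 _ hPD).1)
  rw [← hfin]
  exact hst
end
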